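/- arXiv:2012.10015 — 2 statements merged into one kernel-verified Lean document; each statement's English description precedes it below -/
import Mathlib

section
/- Let n be a positive integer, ω an integer coprime to n, and k an integer with g = gcd(n, k) < n. Then η_{n,ω,k} = (ord_n(ω) / ord_{n/g}(ω)) · η_{n/g, ω, k/g}, where ord_m(ω) denotes the multiplicative order of ω modulo m. In particular, η_{n,ω,k} is a positive integer multiple of the Gaussian period η_{n/g, ω, k/g}. -/
/-- The Gaussian period `η_{n,ω,k} = Σ_{j=0}^{d-1} exp(2πi ω^j k / n)` where
`d = ord_n(ω)` is the multiplicative order of `ω` modulo `n`. -/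
noncomputable def gaussianPeriod (n : ℕ) (ω k : ℤ) : ℂ :=
  ∑ j ∈ Finset.range (orderOf ((ω : ZMod n))),
    Complex.exp (2 * Real.pi * Complex.I * ((ω ^ j * k : ℤ) : ℂ) / (n : ℂ))

/-- The sum of a `d`-periodic sequence over `q` periods. -/
theorem Function.Periodic.sum_range_mul {M : Type*} [AddCommMonoid M] {f : ℕ → M} {d : ℕ}
    (hf : Function.Periodic f d) (q : ℕ) :
    ∑ j ∈ Finset.range (q * d), f j = q • ∑ j ∈ Finset.range d, f j := by
  induction q with
  | zero => simp
  | succ q ih =>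
    rw [Nat.succ_mul, Finset.sum_range_add, ih, succ_nsmul]
    congr 1
    refine Finset.sum_congr rfl fun j _ => ?_
    rw [add_comm]
    exact hf.nat_mul q j

/-- `exp (2πi a / m)` depends only on `a` modulo `m`. -/
theorem Complex.exp_two_pi_I_mul_div_congr {m : ℕ} (hm : m ≠ 0) {a b : ℤ}
    (h : (a : ZMod m) = b) :
    Complex.exp (2 * Real.pi * Complex.I * (a : ℂ) / (m : ℂ)) =
      Complex.exp (2 * Real.pi * Complex.I * (b : ℂ) / (m : ℂ)) := by
  obtain ⟨c, hc⟩ := (ZMod.intCast_eq_intCast_iff_dvd_sub b a m).1 h.symm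
  obtain rfl : a = b + m * c := by lia
  rw [Complex.exp_eq_exp_iff_exists_int]
  refine ⟨c, ?_⟩
  have : (m : ℂ) ≠ 0 := by exact_mod_cast hm
  push_cast
  field_simp

/-- The order of an integer modulo `m` divides its order modulo any multiple of `m`. -/
theorem ZMod.orderOf_intCast_dvd_of_dvd {m n : ℕ} (h : m ∣ n) (ω : ℤ) :
    orderOf (ω : ZMod m) ∣ orderOf (ω : ZMod n) := by
  simpa using orderOf_map_dvd (ZMod.castHom h (ZMod m)).toMonoidHom (ω : ZMod n)

/-- An integer coprime to `n > 0` has positive multiplicative order modulo `n`. -/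
theorem ZMod.orderOf_intCast_pos {n : ℕ} (hn : 0 < n) {ω : ℤ} (hω : Int.gcd ω n = 1) :
    0 < orderOf (ω : ZMod n) := by
  have : NeZero n := ⟨hn.ne'⟩
  obtain ⟨u, hu⟩ := (ZMod.coe_int_isUnit_iff_isCoprime ω n).2
    (Int.isCoprime_iff_gcd_eq_one.2 hω).symm
  rw [← hu, orderOf_units]
  exact orderOf_pos u

/-- If `g = gcd(n,k) < n` then `η_{n,ω,k} = (ord_n(ω)/ord_{n/g}(ω)) · η_{n/g,ω,k/g}`;
in particular `η_{n,ω,k}` is a positive integer multiple of `η_{n/g,ω,k/g}`. -/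
theorem gaussianPeriod_eq_mul_of_gcd (n : ℕ) (hn : 0 < n) (ω k : ℤ)
    (hω : Int.gcd ω n = 1) (g : ℕ) (hg : g = Int.gcd (n : ℤ) k) (hgn : g < n) :
    0 < orderOf ((ω : ZMod n)) / orderOf ((ω : ZMod (n / g))) ∧
      gaussianPeriod n ω k =
        ((orderOf ((ω : ZMod n)) / orderOf ((ω : ZMod (n / g))) : ℕ) : ℂ) *
          gaussianPeriod (n / g) ω (k / (g : ℤ)) := by
  have hg0 : 0 < g := hg ▸ Int.gcd_pos_of_ne_zero_left k (by exact_mod_cast hn.ne')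
  obtain ⟨m, rfl⟩ : g ∣ n := by
    rw [hg]
    exact_mod_cast Int.gcd_dvd_left (n : ℤ) k
  obtain ⟨l, rfl⟩ : (g : ℤ) ∣ k := by
    rw [hg]
    exact Int.gcd_dvd_right _ k
  clear hg
  rw [Nat.mul_div_cancel_left m hg0, Int.mul_ediv_cancel_left l (by exact_mod_cast hg0.ne')]
  have hm : m ≠ 0 := (Nat.pos_of_mul_pos_left hn).ne'
  have hD := ZMod.orderOf_intCast_pos hn hω
  obtain ⟨q, hq⟩ := ZMod.orderOf_intCast_dvd_of_dvd (Dvd.intro_left g rfl : m ∣ g * m) ω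
  rw [hq] at hD
  have hd : 0 < orderOf (ω : ZMod m) := Nat.pos_of_mul_pos_right hD
  have hq0 : 0 < q := Nat.pos_of_mul_pos_left hD
  rw [hq, Nat.mul_div_cancel_left q hd]
  refine ⟨hq0, ?_⟩
  have hper : Function.Periodic (fun j : ℕ =>
      Complex.exp (2 * Real.pi * Complex.I * ((ω ^ j * l : ℤ) : ℂ) / (m : ℂ)))
      (orderOf (ω : ZMod m)) := fun j =>
    Complex.exp_two_pi_I_mul_div_congr hm (by simp [pow_add, pow_orderOf_eq_one])
  unfold gaussianPeriod
  rw [hq, mul_comm _ q]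
  refine Eq.trans ?_ ((hper.sum_range_mul q).trans (nsmul_eq_mul _ _))
  refine Finset.sum_congr rfl fun j _ => ?_
  have : (g : ℂ) ≠ 0 := by exact_mod_cast hg0.ne'
  have : (m : ℂ) ≠ 0 := by exact_mod_cast hm
  congr 1
  push_cast
  field_simp
end

section
/- Let n be a positive integer, ω an integer coprime to n, and set g = gcd(ω − 1, n). Then for all integers k and m, one has exp(2πi m / g) · η_{n,ω,k} = η_{n,ω,k + m·(n/g)}. In particular, the set G(n,ω) is invariant under rotation by angle 2π/g about the origin. -/
/-- The set `G(n,ω) = {η_{n,ω,k} : k = 1, …, n} ⊆ ℂ`. -/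
noncomputable def gaussSet (n : ℕ) (ω : ℤ) : Set ℂ :=
  (fun k : ℤ => gaussianPeriod n ω k) '' (Set.Icc 1 (n : ℤ))

theorem gaussianPeriod_add_mul (n : ℕ) (hn : 0 < n) (ω k t : ℤ) :
    gaussianPeriod n ω (k + n * t) = gaussianPeriod n ω k := by
  have hn' : (n : ℂ) ≠ 0 := by exact_mod_cast hn.ne'
  refine Finset.sum_congr rfl fun j _ => ?_
  rw [Complex.exp_eq_exp_iff_exists_int]
  refine ⟨ω ^ j * t, ?_⟩
  push_cast
  field_simp

theorem exp_mul_gaussianPeriod (n g c : ℕ) (hn : 0 < n) (hc : n = g * c) (ω : ℤ)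
    (hg : (g : ℤ) ∣ ω - 1) (k m : ℤ) :
    Complex.exp (2 * Real.pi * Complex.I * (m : ℂ) / (g : ℂ)) * gaussianPeriod n ω k =
      gaussianPeriod n ω (k + m * c) := by
  have hgc : g * c ≠ 0 := hc ▸ hn.ne'
  have hg0 : (g : ℂ) ≠ 0 := by exact_mod_cast left_ne_zero_of_mul hgc
  have hc0 : (c : ℂ) ≠ 0 := by exact_mod_cast right_ne_zero_of_mul hgc
  unfold gaussianPeriod
  rw [Finset.mul_sum]
  refine Finset.sum_congr rfl fun j _ => ?_
  obtain ⟨t, ht⟩ := hg.trans (by simpa using sub_dvd_pow_sub_pow ω 1 j)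
  rw [sub_eq_iff_eq_add] at ht
  rw [← Complex.exp_add, Complex.exp_eq_exp_iff_exists_int]
  refine ⟨-(t * m), ?_⟩
  rw [ht, hc]
  push_cast
  field_simp
  ring

/-- With `g = gcd(ω-1, n)`, one has `exp(2πi m/g) · η_{n,ω,k} = η_{n,ω,k+m(n/g)}`;
in particular `G(n,ω)` is invariant under rotation by `2π/g` about the origin. -/
theorem gaussianPeriod_rotate (n : ℕ) (hn : 0 < n) (ω : ℤ) (hω : Int.gcd ω n = 1)
    (g : ℕ) (hg : g = Int.gcd (ω - 1) (n : ℤ)) :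
    (∀ k m : ℤ,
      Complex.exp (2 * Real.pi * Complex.I * (m : ℂ) / (g : ℂ)) * gaussianPeriod n ω k =
        gaussianPeriod n ω (k + m * ((n : ℤ) / (g : ℤ)))) ∧
      ∀ z ∈ gaussSet n ω,
        Complex.exp (2 * Real.pi * Complex.I / (g : ℂ)) * z ∈ gaussSet n ω := by
  have hgn : g ∣ n := by
    rw [hg]
    exact_mod_cast Int.gcd_dvd_right (ω - 1) (n : ℤ)
  have hgω : (g : ℤ) ∣ ω - 1 := by
    rw [hg]
    exact Int.gcd_dvd_left (ω - 1) (n : ℤ)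
  obtain ⟨c, hc⟩ := hgn
  have hg0 : g ≠ 0 := by
    rintro rfl
    rw [zero_mul] at hc
    exact hn.ne' hc
  have hdiv : (n : ℤ) / (g : ℤ) = c := by
    rw [hc, Nat.cast_mul, Int.mul_ediv_cancel_left _ (by exact_mod_cast hg0)]
  rw [hdiv]
  refine ⟨exp_mul_gaussianPeriod n g c hn hc ω hgω, ?_⟩
  rintro _ ⟨k, -, rfl⟩
  have hn' : (0 : ℤ) < n := by exact_mod_cast hn
  refine ⟨(k + c - 1) % n + 1, ⟨?_, ?_⟩, ?_⟩
  · linarith [Int.emod_nonneg (k + c - 1) hn'.ne']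
  · linarith [Int.emod_lt_of_pos (k + c - 1) hn']
  · have h := exp_mul_gaussianPeriod n g c hn hc ω hgω k 1
    rw [Int.cast_one, mul_one, one_mul] at h
    simp only [h]
    rw [← gaussianPeriod_add_mul n hn ω _ ((k + c - 1) / n)]
    congr 1
    linarith [Int.emod_add_mul_ediv (k + c - 1) n]
end
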